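/- Let A ∈ ℂ^{m×m}, B ∈ ℂ^{n×n}, C ∈ ℂ^{m×n}. The Smith iteration X_{k+1} = A·X̄_k·B + C converges, for every initial matrix X₀ ∈ ℂ^{m×n}, to the unique solution X★ of the equation X = AX̄B + C if and only if ρ(AĀ)·ρ(B̄B) < 1. (In particular, when ρ(AĀ)ρ(B̄B) < 1 the equation has a unique solution and the iteration converges to it for every X₀; conversely, if the iteration converges for every X₀ then ρ(AĀ)ρ(B̄B) < 1.) -/

import Mathlib

open Matrix Filter

/-- Entrywise complex conjugate. -/
def conjM {m n : ℕ} (A : Matrix (Fin m) (Fin n) ℂ) : Matrix (Fin m) (Fin n) ℂ :=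
  A.map (starRingEnd ℂ)

section

attribute [local instance] Matrix.linftyOpNormedAddCommGroup Matrix.linftyOpNormedRing
  Matrix.linftyOpNormedAlgebra

/-- The real-linear operator `X ↦ AX̄B`. -/
noncomputable def conjSylvester {m n : ℕ} (A : Matrix (Fin m) (Fin m) ℂ)
    (B : Matrix (Fin n) (Fin n) ℂ) :
    Matrix (Fin m) (Fin n) ℂ →ₗ[ℝ] Matrix (Fin m) (Fin n) ℂ where
  toFun X := A * conjM X * B
  map_add' X Y := by
    simp [conjM, Matrix.map_add, Matrix.mul_add, Matrix.add_mul]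
  map_smul' r X := by
    have h : conjM (r • X) = r • conjM X := by
      ext i j
      simp [conjM]
    simp [h]

variable {m n : ℕ} (A : Matrix (Fin m) (Fin m) ℂ) (B : Matrix (Fin n) (Fin n) ℂ)

theorem conjSylvester_apply (X : Matrix (Fin m) (Fin n) ℂ) :
    conjSylvester A B X = A * conjM X * B := rfl

theorem conjSylvester_comp_self (X : Matrix (Fin m) (Fin n) ℂ) :
    conjSylvester A B (conjSylvester A B X) = (A * conjM A) * X * (conjM B * B) := by
  have hX : (X.map (starRingEnd ℂ)).map (starRingEnd ℂ) = X := by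
    ext i j
    simp
  simp only [conjSylvester_apply, conjM, Matrix.map_mul, hX, Matrix.mul_assoc]

theorem conjSylvester_iterate_two_mul (X : Matrix (Fin m) (Fin n) ℂ) (k : ℕ) :
    (conjSylvester A B)^[2 * k] X = (A * conjM A) ^ k * X * (conjM B * B) ^ k := by
  induction k with
  | zero => simp
  | succ k ih =>
    rw [Nat.mul_succ, Nat.add_comm, Function.iterate_add_apply, ih, Function.iterate_succ_apply,
      Function.iterate_one, conjSylvester_comp_self, pow_succ' (A * conjM A), pow_succ (conjM B * B)]
    simp only [Matrix.mul_assoc]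

theorem tendsto_norm_pow_mul_norm_pow_of_spectralRadius_mul_lt_one
    {P : Matrix (Fin m) (Fin m) ℂ} {Q : Matrix (Fin n) (Fin n) ℂ}
    (h : spectralRadius ℂ P * spectralRadius ℂ Q < 1) :
    Tendsto (fun k : ℕ => ‖P ^ k‖ * ‖Q ^ k‖) atTop (nhds 0) := by
  have : CompleteSpace (Matrix (Fin m) (Fin m) ℂ) := FiniteDimensional.complete ℂ _
  have : CompleteSpace (Matrix (Fin n) (Fin n) ℂ) := FiniteDimensional.complete ℂ _
  have hfin : ∀ {l : ℕ} (M : Matrix (Fin l) (Fin l) ℂ), spectralRadius ℂ M ≠ ⊤ := by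
    intro l M
    refine ((spectrum.spectralRadius_le_pow_nnnorm_pow_one_div ℂ M 0).trans_lt ?_).ne
    exact ENNReal.mul_lt_top (by simp) (by simp)
  have hlim := ENNReal.Tendsto.mul (spectrum.pow_nnnorm_pow_one_div_tendsto_nhds_spectralRadius P)
    (Or.inr (hfin Q)) (spectrum.pow_nnnorm_pow_one_div_tendsto_nhds_spectralRadius Q)
    (Or.inr (hfin P))
  obtain ⟨r, hr, hr1⟩ := ENNReal.lt_iff_exists_nnreal_btwn.mp h
  have hr1 : r < 1 := by exact_mod_cast hr1
  have hbound : ∀ᶠ k : ℕ in atTop, ‖P ^ k‖ * ‖Q ^ k‖ ≤ (r : ℝ) ^ k := by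
    filter_upwards [hlim.eventually_lt_const hr, eventually_gt_atTop 0] with k hk hk0
    rw [← ENNReal.mul_rpow_of_nonneg _ _ (by positivity), one_div,
      ENNReal.rpow_inv_lt_iff (by positivity), ENNReal.rpow_natCast] at hk
    exact_mod_cast hk.le
  exact squeeze_zero' (Eventually.of_forall fun k => by positivity) hbound
    (tendsto_pow_atTop_nhds_zero_of_lt_one r.2 (by exact_mod_cast hr1))

variable {A B}

theorem tendsto_conjSylvester_iterate
    (h : spectralRadius ℂ (A * conjM A) * spectralRadius ℂ (conjM B * B) < 1)
    (X : Matrix (Fin m) (Fin n) ℂ) :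
    Tendsto (fun k => (conjSylvester A B)^[k] X) atTop (nhds 0) := by
  have heven : ∀ Y : Matrix (Fin m) (Fin n) ℂ,
      Tendsto (fun k => (conjSylvester A B)^[2 * k] Y) atTop (nhds 0) := by
    intro Y
    refine tendsto_zero_iff_norm_tendsto_zero.mpr ?_
    have hlim := (tendsto_norm_pow_mul_norm_pow_of_spectralRadius_mul_lt_one h).mul_const ‖Y‖
    rw [zero_mul] at hlim
    refine squeeze_zero (fun _ => norm_nonneg _) (fun k => ?_) hlim
    rw [conjSylvester_iterate_two_mul]
    calc _ ≤ ‖(A * conjM A) ^ k * Y‖ * ‖(conjM B * B) ^ k‖ := linfty_opNorm_mul _ _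
      _ ≤ ‖(A * conjM A) ^ k‖ * ‖Y‖ * ‖(conjM B * B) ^ k‖ := by
        gcongr
        exact linfty_opNorm_mul _ _
      _ = _ := by ring
  have hodd := heven (conjSylvester A B X)
  simp only [← Function.iterate_succ_apply] at hodd
  intro U hU
  obtain ⟨K, hK⟩ := eventually_atTop.mp ((heven X).eventually hU)
  obtain ⟨L, hL⟩ := eventually_atTop.mp (hodd.eventually hU)
  refine mem_map.mpr (mem_atTop_sets.mpr ⟨2 * K + 2 * L, fun k hk => ?_⟩)
  obtain ⟨l, rfl | rfl⟩ := k.even_or_odd'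
  · exact hK l (by lia)
  · exact hL l (by lia)

theorem exists_mulVec_eq_smul_of_mem_spectrum {P : Matrix (Fin m) (Fin m) ℂ} {c : ℂ}
    (hc : c ∈ spectrum ℂ P) : ∃ v ≠ 0, P *ᵥ v = c • v := by
  rw [spectrum.mem_iff, Matrix.isUnit_iff_isUnit_det, isUnit_iff_ne_zero, not_not,
    ← Matrix.exists_mulVec_eq_zero_iff] at hc
  obtain ⟨v, hv, h⟩ := hc
  refine ⟨v, hv, ?_⟩
  rw [Matrix.sub_mulVec, sub_eq_zero, Algebra.algebraMap_eq_smul_one, Matrix.smul_mulVec,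
    Matrix.one_mulVec] at h
  exact h.symm

theorem exists_vecMul_eq_smul_of_mem_spectrum {P : Matrix (Fin m) (Fin m) ℂ} {c : ℂ}
    (hc : c ∈ spectrum ℂ P) : ∃ v ≠ 0, v ᵥ* P = c • v := by
  rw [spectrum.mem_iff, Matrix.isUnit_iff_isUnit_det, isUnit_iff_ne_zero, not_not,
    ← Matrix.exists_vecMul_eq_zero_iff] at hc
  obtain ⟨v, hv, h⟩ := hc
  refine ⟨v, hv, ?_⟩
  rw [Matrix.vecMul_sub, sub_eq_zero, Algebra.algebraMap_eq_smul_one, Matrix.vecMul_smul,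
    Matrix.vecMul_one] at h
  exact h.symm

theorem exists_mem_spectrum_enorm_eq_spectralRadius {P : Matrix (Fin m) (Fin m) ℂ}
    (hP : spectralRadius ℂ P ≠ 0) : ∃ c ∈ spectrum ℂ P, ‖c‖ₑ = spectralRadius ℂ P := by
  have : CompleteSpace (Matrix (Fin m) (Fin m) ℂ) := FiniteDimensional.complete ℂ _
  have : Nontrivial (Matrix (Fin m) (Fin m) ℂ) := by
    by_contra hsub
    rw [not_nontrivial_iff_subsingleton] at hsub
    exact hP (spectrum.SpectralRadius.of_subsingleton P)
  exact spectrum.exists_nnnorm_eq_spectralRadius P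

theorem spectralRadius_mul_lt_one_of_tendsto
    (h : ∀ X : Matrix (Fin m) (Fin n) ℂ,
      Tendsto (fun k => (conjSylvester A B)^[k] X) atTop (nhds 0)) :
    spectralRadius ℂ (A * conjM A) * spectralRadius ℂ (conjM B * B) < 1 := by
  by_contra! hge
  obtain ⟨a, ha, hna⟩ := exists_mem_spectrum_enorm_eq_spectralRadius (P := A * conjM A)
    (by rintro h0; simp [h0] at hge)
  obtain ⟨b, hb, hnb⟩ := exists_mem_spectrum_enorm_eq_spectralRadius (P := conjM B * B)
    (by rintro h0; simp [h0] at hge)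
  rw [← hna, ← hnb, ← enorm_mul, ← ofReal_norm, ENNReal.one_le_ofReal] at hge
  obtain ⟨x, hx, hax⟩ := exists_mulVec_eq_smul_of_mem_spectrum ha
  obtain ⟨y, hy, hby⟩ := exists_vecMul_eq_smul_of_mem_spectrum hb
  have hpow : ∀ k : ℕ, (conjSylvester A B)^[2 * k] (vecMulVec x y) =
      (a * b) ^ k • vecMulVec x y := by
    intro k
    induction k with
    | zero => simp
    | succ k ih =>
      rw [conjSylvester_iterate_two_mul] at ih ⊢
      rw [pow_succ (A * conjM A), pow_succ' (conjM B * B)]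
      have : (A * conjM A) * vecMulVec x y * (conjM B * B) = (a * b) • vecMulVec x y := by
        rw [mul_vecMulVec, vecMulVec_mul, hax, hby, smul_vecMulVec, vecMulVec_smul, smul_smul]
      calc _ = (A * conjM A) ^ k * ((A * conjM A) * vecMulVec x y * (conjM B * B)) *
            (conjM B * B) ^ k := by simp only [Matrix.mul_assoc]
        _ = _ := by
          rw [this, Matrix.mul_smul, Matrix.smul_mul, ih, smul_smul, pow_succ']
  have hlim := (h (vecMulVec x y)).comp
    (tendsto_id.const_mul_atTop' (by norm_num : 0 < 2) : Tendsto (fun k : ℕ => 2 * k) atTop atTop)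
  obtain ⟨i, hi⟩ := Function.ne_iff.mp hx
  obtain ⟨j, hj⟩ := Function.ne_iff.mp hy
  have hij := ((continuous_apply_apply i j).tendsto _).comp hlim
  have hnorm := hij.norm
  have hle : ‖x i * y j‖ ≤ 0 := by
    refine le_of_tendsto_of_tendsto' tendsto_const_nhds (by simpa using hnorm) fun k => ?_
    change _ ≤ ‖((conjSylvester A B)^[2 * k] (vecMulVec x y)) i j‖
    rw [hpow, Matrix.smul_apply, vecMulVec_apply, norm_smul, norm_pow]
    exact le_mul_of_one_le_left (norm_nonneg _) (one_le_pow₀ hge)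
  exact (norm_pos_iff.mpr (mul_ne_zero hi hj)).not_ge hle

theorem smith_sub_eq_iterate {C Xs : Matrix (Fin m) (Fin n) ℂ} (hXs : Xs = A * conjM Xs * B + C)
    {X : ℕ → Matrix (Fin m) (Fin n) ℂ} (hX : ∀ k, X (k + 1) = A * conjM (X k) * B + C) (k : ℕ) :
    X k - Xs = (conjSylvester A B)^[k] (X 0 - Xs) := by
  induction k with
  | zero => rfl
  | succ k ih =>
    rw [Function.iterate_succ_apply', ← ih, map_sub, conjSylvester_apply, conjSylvester_apply, hX]
    nth_rw 1 [hXs]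
    abel

end

/-- The Smith iteration `X_{k+1} = AX̄_kB + C` converges, for every
initial matrix, to the unique solution of `X = AX̄B + C` iff `ρ(AĀ)·ρ(B̄B) < 1`. -/
theorem smith_iteration_AconjXB_converges_iff {m n : ℕ}
    (A : Matrix (Fin m) (Fin m) ℂ) (B : Matrix (Fin n) (Fin n) ℂ)
    (C : Matrix (Fin m) (Fin n) ℂ) :
    (∃ Xs : Matrix (Fin m) (Fin n) ℂ,
      (Xs = A * conjM Xs * B + C ∧
        ∀ Y : Matrix (Fin m) (Fin n) ℂ, Y = A * conjM Y * B + C → Y = Xs) ∧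
      ∀ X : ℕ → Matrix (Fin m) (Fin n) ℂ,
        (∀ k : ℕ, X (k + 1) = A * conjM (X k) * B + C) →
        Tendsto X atTop (nhds Xs)) ↔
    spectralRadius ℂ (A * conjM A) * spectralRadius ℂ (conjM B * B) < 1 := by
  constructor
  · rintro ⟨Xs, ⟨hXs, -⟩, hconv⟩
    refine spectralRadius_mul_lt_one_of_tendsto fun W => ?_
    set X : ℕ → Matrix (Fin m) (Fin n) ℂ :=
      fun k => (fun Y => A * conjM Y * B + C)^[k] (Xs + W) with hXdef
    have hX : ∀ k, X (k + 1) = A * conjM (X k) * B + C :=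
      fun k => Function.iterate_succ_apply' _ _ _
    have hlim := (hconv X hX).sub_const Xs
    have hX0 : X 0 - Xs = W := by simp [hXdef]
    have hiter : (fun k => X k - Xs) = fun k => (conjSylvester A B)^[k] W :=
      funext fun k => (smith_sub_eq_iterate hXs hX k).trans (by rw [hX0])
    rwa [hiter, sub_self] at hlim
  · intro h
    have hker : ∀ X, conjSylvester A B X = X → X = 0 := by
      intro X hX
      have hlim := tendsto_conjSylvester_iterate h X
      simp only [Function.iterate_fixed hX] at hlim
      exact tendsto_nhds_unique tendsto_const_nhds hlim
    have hinj : Function.Injective (LinearMap.id - conjSylvester A B :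
        Matrix (Fin m) (Fin n) ℂ →ₗ[ℝ] Matrix (Fin m) (Fin n) ℂ) := by
      refine (injective_iff_map_eq_zero _).mpr fun X hX => hker X ?_
      exact (sub_eq_zero.mp hX).symm
    obtain ⟨Xs, hXs⟩ := LinearMap.injective_iff_surjective.mp hinj C
    have hfix : Xs = A * conjM Xs * B + C := by
      rw [← hXs, LinearMap.sub_apply, conjSylvester_apply, LinearMap.id_apply]
      abel
    refine ⟨Xs, ⟨hfix, fun Y hY => hinj ?_⟩, fun X hX => ?_⟩
    · rw [hXs, LinearMap.sub_apply, conjSylvester_apply, LinearMap.id_apply, sub_eq_iff_eq_add']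
      exact hY
    · have hlim := (tendsto_conjSylvester_iterate h (X 0 - Xs)).add_const Xs
      simpa [← smith_sub_eq_iterate hfix hX] using hlim
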